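/- arXiv:2305.14541 — 2 statements merged into one kernel-verified Lean document; each statement's English description precedes it below -/
import Mathlib

section
/- List-refinement bound when the true trajectory exceeds the reference trajectory (Lemma thm:traj_lr). There exists ε⁰ > 0, depending only on q, p, r, and ε_R, such that for every ε_L ∈ (0, ε⁰): for every admissible θ and n, every error–erasure pattern for which t_min exists, and every t ∈ T with t ≥ t_min, if p̂_t < p_t then n·r − Λ_t + 2·(n·p − (t − Λ_t)·p_t) ≤ (q−1)(1−ε_L)(n − t)/q. -/
/-- The q-ary entropy function: `H_q(x) = x·log_q(q−1) − x·log_q(x) − (1−x)·log_q(1−x)`.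
With the convention `Real.logb b 0 = 0` this gives `H_q(0) = 0` and `H_q(1) = log_q(q−1)`. -/
noncomputable def Hq (q : ℕ) (x : ℝ) : ℝ :=
  x * Real.logb q ((q : ℝ) - 1) - x * Real.logb q x - (1 - x) * Real.logb q (1 - x)

/-- `α(p̄) = 1 − (2q/(q−1))(p − p̄) − (q/(q−1))r`. -/
noncomputable def alphaEE (q : ℕ) (p r pb : ℝ) : ℝ :=
  1 - (2 * (q : ℝ) / ((q : ℝ) - 1)) * (p - pb) - ((q : ℝ) / ((q : ℝ) - 1)) * r

/-- `C₀(q,p,r) = min_{p̄ ∈ [0,p]} α(p̄)·(1 − H_q(p̄/α(p̄)))` (the minimum is attained,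
so it equals the infimum). -/
noncomputable def C0 (q : ℕ) (p r : ℝ) : ℝ :=
  sInf ((fun pb => alphaEE q p r pb * (1 - Hq q (pb / alphaEE q p r pb))) '' Set.Icc 0 p)

/-- An error–erasure pattern for blocklength `n = s·K` with feedback resolution
`θ = 1/K = s/n`, error fraction `p` and erasure fraction `r`. The time instants of
the set `T = {θn, 2θn, …, (1−θ)n}` are `t = j·s` for `j = 1,…,K−1`; `lam j` is the
cumulative number of erasures among the first `j·s` positions and `E j` the cumulative
number of symbol errors among the first `j·s − lam j` unerased positions. -/
structure EEPattern (p r : ℝ) (n s K : ℕ) where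
  lam : ℕ → ℕ
  E : ℕ → ℕ
  mono_lam : ∀ j : ℕ, 1 ≤ j → j + 1 ≤ K - 1 → lam j ≤ lam (j + 1)
  mono_E : ∀ j : ℕ, 1 ≤ j → j + 1 ≤ K - 1 → E j ≤ E (j + 1)
  lam_le : ∀ j : ℕ, 1 ≤ j → j ≤ K - 1 → lam j ≤ j * s ∧ (lam j : ℝ) ≤ r * n
  E_le : ∀ j : ℕ, 1 ≤ j → j ≤ K - 1 → E j + lam j ≤ j * s ∧ (E j : ℝ) ≤ p * n
  incr : ∀ j : ℕ, 2 ≤ j → j ≤ K - 1 →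
    (lam j - lam (j - 1)) + (E j - E (j - 1)) ≤ s

namespace EEPattern

variable {p r : ℝ} {n s K : ℕ}

/-- The adversary's error trajectory `p_t = E_t/(t − Λ_t)` at time `t = j·s`. -/
noncomputable def pt (P : EEPattern p r n s K) (j : ℕ) : ℝ :=
  (P.E j : ℝ) / (((j * s : ℕ) : ℝ) - (P.lam j : ℝ))

end EEPattern

/-- The set of indices `j` (times `t = j·s ∈ T`) at which `t − Λ_t > n(R + ε_L)`;
`t_min` is its least element. -/
def tminSet (R εL : ℝ) {p r : ℝ} {n s K : ℕ} (P : EEPattern p r n s K) : Set ℕ :=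
  {j : ℕ | 1 ≤ j ∧ j ≤ K - 1 ∧ (n : ℝ) * (R + εL) < ((j * s : ℕ) : ℝ) - (P.lam j : ℝ)}

/-- `phat` is a reference trajectory for the pattern `P` (relative to `jmin = t_min/s`):
for every time `t = j·s ∈ T` with `t ≥ t_min`, `p̂_t ∈ [0,(q−1)/q]` and
`(t − Λ_t)(1 − H_q(p̂_t)) = n(R + ε_L)`. -/
def IsRefTraj (q : ℕ) (R εL : ℝ) {p r : ℝ} {n s K : ℕ}
    (P : EEPattern p r n s K) (jmin : ℕ) (phat : ℕ → ℝ) : Prop :=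
  ∀ j : ℕ, jmin ≤ j → j ≤ K - 1 →
    phat j ∈ Set.Icc (0 : ℝ) (((q : ℝ) - 1) / q) ∧
    (((j * s : ℕ) : ℝ) - (P.lam j : ℝ)) * (1 - Hq q (phat j)) = (n : ℝ) * (R + εL)

/-- Gibbs' inequality: the entropy is bounded by the tangent line at `y`, written as a
cross-entropy. -/
theorem Hq_le_cross (q : ℕ) (hq : 2 ≤ q) {x y : ℝ} (hx0 : 0 ≤ x) (hx1 : x ≤ 1)
    (hy0 : 0 < y) (hy1 : y < 1) :
    Hq q x ≤ x * Real.logb q ((q : ℝ) - 1) - x * Real.logb q y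
      - (1 - x) * Real.logb q (1 - y) := by
  have gibbs : ∀ a b : ℝ, 0 ≤ a → 0 < b → a * Real.log b - a * Real.log a ≤ b - a := by
    intro a b ha hb
    rcases ha.eq_or_lt with rfl | ha
    · simpa using hb.le
    · have h := Real.log_le_sub_one_of_pos (div_pos hb ha)
      rw [Real.log_div hb.ne' ha.ne'] at h
      have h2 := mul_le_mul_of_nonneg_left h ha.le
      have h3 : a * (b / a - 1) = b - a := by field_simp
      linarith
  have hl : 0 < Real.log q := Real.log_pos (by exact_mod_cast hq)
  have h1 := gibbs x y hx0 hy0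
  have h2 := gibbs (1 - x) (1 - y) (by linarith) (by linarith)
  have h3 : (x * Real.log y - x * Real.log x
      + ((1 - x) * Real.log (1 - y) - (1 - x) * Real.log (1 - x))) / Real.log q ≤ 0 :=
    div_nonpos_of_nonpos_of_nonneg (by linarith) hl.le
  have h4 : (x * Real.log y - x * Real.log x
      + ((1 - x) * Real.log (1 - y) - (1 - x) * Real.log (1 - x))) / Real.log q
      = x * Real.logb q y - x * Real.logb q x
        + ((1 - x) * Real.logb q (1 - y) - (1 - x) * Real.logb q (1 - x)) := by
    simp only [Real.logb]; ring
  unfold Hq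
  linarith

theorem logb_one_sub_mem_Icc (q : ℕ) (hq : 2 ≤ q) {y : ℝ} (hy0 : 0 ≤ y)
    (hy : y ≤ ((q : ℝ) - 1) / q) : Real.logb q (1 - y) ∈ Set.Icc (-1 : ℝ) 0 := by
  have hq' : (2 : ℝ) ≤ q := by exact_mod_cast hq
  have hinv : ((q : ℝ) - 1) / q = 1 - (q : ℝ)⁻¹ := by field_simp
  have hpos : (0 : ℝ) < (q : ℝ)⁻¹ := by positivity
  constructor
  · have h := Real.logb_le_logb_of_le (b := (q : ℝ)) (by linarith) hpos
      (show (q : ℝ)⁻¹ ≤ 1 - y by linarith)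
    rwa [Real.logb_inv, Real.logb_self_eq_one (by linarith)] at h
  · exact Real.logb_nonpos (by linarith) (by linarith) (by linarith)

theorem logb_slope_nonneg (q : ℕ) (hq : 2 ≤ q) {y : ℝ} (hy0 : 0 < y)
    (hy : y ≤ ((q : ℝ) - 1) / q) :
    0 ≤ Real.logb q ((q : ℝ) - 1) - Real.logb q y + Real.logb q (1 - y) := by
  have hq' : (2 : ℝ) ≤ q := by exact_mod_cast hq
  rw [le_div_iff₀ (by linarith)] at hy
  have hy1 : 0 < 1 - y := by nlinarith
  have h := Real.logb_le_logb_of_le (b := (q : ℝ)) (by linarith) hy0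
    (show y ≤ ((q : ℝ) - 1) * (1 - y) by linarith)
  rw [Real.logb_mul (by linarith) hy1.ne'] at h
  linarith

theorem Hq_le_one (q : ℕ) (hq : 2 ≤ q) {x : ℝ} (hx0 : 0 ≤ x) (hx1 : x ≤ 1) : Hq q x ≤ 1 := by
  have hq' : (2 : ℝ) ≤ q := by exact_mod_cast hq
  have hinv : 1 - ((q : ℝ) - 1) / q = (q : ℝ)⁻¹ := by field_simp; ring
  have hpos : (0 : ℝ) < (q : ℝ)⁻¹ := by positivity
  have h := Hq_le_cross q hq hx0 hx1 (y := ((q : ℝ) - 1) / q)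
    (div_pos (by linarith) (by linarith)) (by linarith)
  rw [hinv, Real.logb_inv, Real.logb_div (by linarith) (by linarith),
    Real.logb_self_eq_one (by linarith)] at h
  linarith

theorem alphaEE_mul (q : ℕ) (hq : 2 ≤ q) (p r pb : ℝ) :
    ((q : ℝ) - 1) / q * alphaEE q p r pb
      = ((q : ℝ) - 1) / q - 2 * (p - pb) - r := by
  have hq' : (2 : ℝ) ≤ q := by exact_mod_cast hq
  have h0 : (q : ℝ) - 1 ≠ 0 := by linarith
  unfold alphaEE
  field_simp

theorem alphaEE_pos (q : ℕ) (hq : 2 ≤ q) {p r pb : ℝ} (hpb : 0 ≤ pb)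
    (hpr : 2 * p + r < ((q : ℝ) - 1) / q) : 0 < alphaEE q p r pb := by
  have hq' : (2 : ℝ) ≤ q := by exact_mod_cast hq
  have hQ : 0 < ((q : ℝ) - 1) / q := div_pos (by linarith) (by linarith)
  have h := alphaEE_mul q hq p r pb
  exact pos_of_mul_pos_right (by linarith) hQ.le

theorem div_alphaEE_le (q : ℕ) (hq : 2 ≤ q) {p r pb : ℝ} (hpb : 0 ≤ pb)
    (hpr : 2 * p + r < ((q : ℝ) - 1) / q) :
    pb / alphaEE q p r pb ≤ ((q : ℝ) - 1) / q := by
  rw [div_le_iff₀ (alphaEE_pos q hq hpb hpr), alphaEE_mul q hq]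
  linarith

theorem q_sub_one_div_lt_one (q : ℕ) (hq : 2 ≤ q) : ((q : ℝ) - 1) / q < 1 := by
  have hq' : (2 : ℝ) ≤ q := by exact_mod_cast hq
  rw [div_lt_one (by linarith)]
  linarith

theorem C0_le (q : ℕ) (hq : 2 ≤ q) {p r pb : ℝ} (hpb : pb ∈ Set.Icc 0 p)
    (hpr : 2 * p + r < ((q : ℝ) - 1) / q) :
    C0 q p r ≤ alphaEE q p r pb * (1 - Hq q (pb / alphaEE q p r pb)) := by
  refine csInf_le ⟨0, ?_⟩ ⟨pb, hpb, rfl⟩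
  rintro _ ⟨x, hx, rfl⟩
  have hα := alphaEE_pos q hq hx.1 hpr
  have h := Hq_le_one q hq (div_nonneg hx.1 hα.le)
    ((div_alphaEE_le q hq hx.1 hpr).trans (q_sub_one_div_lt_one q hq).le)
  exact mul_nonneg hα.le (by linarith)

/-- If a fraction `e` of errors among a fraction `u` of unerased symbols exceeds `x`, and
`u` is within `ε` of `α(e)` from below, then the rate `u(1 - H_q(x))` is at least `C₀ - ε`. -/
theorem C0_sub_le_rate (q : ℕ) (hq : 2 ≤ q) {p r e u x ε : ℝ}
    (hpr : 2 * p + r < ((q : ℝ) - 1) / q) (he : 0 < e) (hep : e ≤ p) (hu : 0 ≤ u)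
    (hx : x ∈ Set.Icc (0 : ℝ) (((q : ℝ) - 1) / q)) (hxe : u * x ≤ e) (hε : 0 ≤ ε)
    (huα : alphaEE q p r e - ε ≤ u) :
    C0 q p r - ε ≤ u * (1 - Hq q x) := by
  have hC := C0_le q hq ⟨he.le, hep⟩ hpr
  have hv := alphaEE_pos q hq he.le hpr
  have hy := div_alphaEE_le q hq he.le hpr
  have hvy : alphaEE q p r e * (e / alphaEE q p r e) = e := mul_div_cancel₀ e hv.ne'
  have hy0 := div_pos he hv
  generalize alphaEE q p r e = v at *
  generalize e / v = y at *
  have hQ := q_sub_one_div_lt_one q hq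
  obtain ⟨hl1, hl0⟩ := logb_one_sub_mem_Icc q hq hy0.le hy
  have hG := mul_le_mul_of_nonneg_left
    (Hq_le_cross q hq hx.1 (hx.2.trans hQ.le) hy0 (hy.trans_lt hQ)) hu
  have hS := mul_le_mul_of_nonneg_right hxe (logb_slope_nonneg q hq hy0 hy)
  rw [← hvy] at hS
  unfold Hq at hC
  have hT : -ε ≤ (u - v) * (1 + Real.logb q (1 - y)) := by nlinarith
  linarith

theorem alphaEE_sub_lt (q : ℕ) (hq : 2 ≤ q) {p r e l t ε : ℝ} (hl : 0 ≤ l) (ht : 0 ≤ t)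
    (hε : 0 ≤ ε)
    (h : ((q : ℝ) - 1) / q * ((1 - ε) * (1 - t)) < r - l + 2 * (p - e)) :
    alphaEE q p r e - ε < t - l := by
  have hq' : (2 : ℝ) ≤ q := by exact_mod_cast hq
  have hQ : 0 < ((q : ℝ) - 1) / q := div_pos (by linarith) (by linarith)
  have hα := alphaEE_mul q hq p r e
  have hQ1 := mul_le_mul_of_nonneg_right (q_sub_one_div_lt_one q hq).le hl
  have ht' := mul_nonneg hQ.le (mul_nonneg hε ht)
  refine lt_of_mul_lt_mul_left ?_ hQ.le
  linarith

/-- List-refinement bound when the true trajectory exceeds the reference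
trajectory (Lemma thm:traj_lr). There exists ε⁰ > 0, depending only on q, p, r, ε_R,
such that for every ε_L ∈ (0, ε⁰): for every admissible θ and n, every error–erasure
pattern for which t_min exists, and every t ∈ T with t ≥ t_min, if p̂_t < p_t then
n·r − Λ_t + 2·(n·p − (t − Λ_t)·p_t) ≤ (q−1)(1−ε_L)(n − t)/q. -/
theorem traj_list_refinement (q : ℕ) (hq : 2 ≤ q) (p r : ℝ)
    (hp : p ∈ Set.Icc (0 : ℝ) 1) (hr : r ∈ Set.Icc (0 : ℝ) 1)
    (hpr : 2 * p + r < ((q : ℝ) - 1) / q)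
    (εR : ℝ) (hεR0 : 0 < εR) (hεR1 : εR < C0 q p r) :
    ∃ ε0 : ℝ, 0 < ε0 ∧ ∀ εL : ℝ, 0 < εL → εL < ε0 →
      ∀ (θ : ℝ) (n s K : ℕ), 0 < θ → θ < 1 → 0 < s →
        (s : ℝ) = θ * n → (K : ℝ) = 1 / θ →
      ∀ P : EEPattern p r n s K, ∀ jmin : ℕ,
        IsLeast (tminSet (C0 q p r - εR) εL P) jmin →
      ∀ phat : ℕ → ℝ, IsRefTraj q (C0 q p r - εR) εL P jmin phat →
      ∀ j : ℕ, jmin ≤ j → j ≤ K - 1 → phat j < P.pt j →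
        (n : ℝ) * r - P.lam j +
            2 * ((n : ℝ) * p - (((j * s : ℕ) : ℝ) - P.lam j) * P.pt j) ≤
          ((q : ℝ) - 1) * (1 - εL) * ((n : ℝ) - ((j * s : ℕ) : ℝ)) / q := by
  refine ⟨εR / 2, by linarith, ?_⟩
  intro εL hεL0 hεL θ n s K hθ0 _ hs hsn _ P jmin _ phat hphat j hj hjK hlt
  obtain ⟨hx, hrate⟩ := hphat j hj hjK
  have hn : (0 : ℝ) < n := by
    have hs' : (0 : ℝ) < s := by exact_mod_cast hs
    rw [hsn] at hs'
    exact pos_of_mul_pos_right hs' hθ0.le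
  have hpt : 0 < P.pt j := hx.1.trans_lt hlt
  have hE0 : 0 < (P.E j : ℝ) := by
    refine (Nat.cast_nonneg _).lt_of_ne fun h => ?_
    simp [EEPattern.pt, ← h] at hpt
  have hU0 : 0 < ((j * s : ℕ) : ℝ) - P.lam j :=
    pos_of_mul_pos_right (b := ((j * s : ℕ) : ℝ) - P.lam j) (a := P.pt j) (by
      have hne : ((j * s : ℕ) : ℝ) - P.lam j ≠ 0 := fun h => by
        simp only [EEPattern.pt, h, div_zero, lt_self_iff_false] at hpt
      rw [EEPattern.pt, div_mul_cancel₀ _ hne]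
      exact hE0) hpt.le
  have hEU : (((j * s : ℕ) : ℝ) - P.lam j) * P.pt j = P.E j := mul_div_cancel₀ _ hU0.ne'
  have hj1 : 1 ≤ j := by
    by_contra h0
    have h00 : j = 0 := by omega
    rw [h00, Nat.zero_mul, Nat.cast_zero] at hU0
    linarith [Nat.cast_nonneg (α := ℝ) (P.lam 0)]
  have hEp := (P.E_le j hj1 hjK).2
  have hL0 : (0 : ℝ) ≤ P.lam j := Nat.cast_nonneg _
  have hxE := (mul_le_mul_of_nonneg_left hlt.le hU0.le).trans_eq hEU
  rw [hEU]
  have hT0 : (0 : ℝ) ≤ ((j * s : ℕ) : ℝ) := Nat.cast_nonneg _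
  generalize ((j * s : ℕ) : ℝ) = T at *
  generalize (P.lam j : ℝ) = L at *
  generalize (P.E j : ℝ) = E at *
  by_contra! hcon
  have hα : alphaEE q p r (E / n) - εL < T / n - L / n := by
    refine alphaEE_sub_lt q hq (by positivity) (by positivity) hεL0.le ?_
    refine lt_of_mul_lt_mul_left (a := (n : ℝ)) ?_ hn.le
    convert hcon using 1 <;> field_simp
  have hR := C0_sub_le_rate q hq (u := T / n - L / n) hpr (div_pos hE0 hn)
    ((div_le_iff₀ hn).2 hEp) (by rw [← sub_div]; positivity) hx
    (by rw [← sub_div, div_mul_eq_mul_div]; gcongr) hεL0.le hα.le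
  have hrate' : (T / n - L / n) * (1 - Hq q (phat j)) = C0 q p r - εR + εL := by
    rw [← sub_div, div_mul_eq_mul_div, hrate]
    field_simp
  linarith
end

section
/- Residual uncertainty after the babble attack (Lemma thm:F_0). Let q ≥ 2 be an integer, let p, r ∈ [0,1] satisfy 2p + r < (q−1)/q, let ε_R > 0, let p̄ ∈ [0,p] be a minimizer defining C₀(q,p,r), set R = C₀(q,p,r) + ε_R, and assume α(p̄) + ε_R/2 ≤ 1. Then for all sufficiently large n for which p̄n and b = (α(p̄) + ε_R/2)n are integers, the following holds for every B-bit feedback code of blocklength n (any B) with message set M of size ⌈q^{Rn}⌉. Let M be uniform on M, and let (X_1,Y_1),…,(X_b,Y_b) be generated by the babble attack. Then P( H(M | Y_b = y) ≥ n·ε_R/4 ) > ε_R/8, where the probability is over the realization y of Y_b = (Y_1,…,Y_b) (jointly over M, the random set S, and the random substituted symbols), and H(M | Y_b = y) denotes the base-q Shannon entropy of the conditional distribution of M given Y_b = y. -/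
/-- The q-ary input alphabet `X = {0,…,q−1}`. -/
abbrev Xq (q : ℕ) := Fin q

/-- The output alphabet `Y = X ∪ {?}`; `none` is the erasure symbol `?`. -/
abbrev Yq (q : ℕ) := Option (Fin q)

/-- A `B`-bit feedback code of blocklength `n` over a `q`-ary alphabet with message set `M`:
feedback times `0 = t 0 < t 1 < ⋯ < t T < t (T+1) = n`, a finite feedback alphabet `Z` with
`T·log₂|Z| ≤ B`, feedback functions `f k : Y^{t (k+1)} → Z` (the `(k+1)`-st feedback symbol
is computed from the received prefix of length `t (k+1)`, for `k = 0,…,T−1` i.e. 1-indexed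
`1,…,T`), encoding functions `enc k : M × Z^k → X^{t (k+1) − t k}` producing the `(k+1)`-st
sub-codeword from the message and the feedback received so far, and a decoder `dec`. -/
structure FeedbackCode (q n B : ℕ) (M : Type*) where
  T : ℕ
  t : ℕ → ℕ
  ht0 : t 0 = 0
  htn : t (T + 1) = n
  htlt : ∀ k, k ≤ T → t k < t (k + 1)
  Z : Type
  instZ : Fintype Z
  hB : (T : ℝ) * Real.logb 2 (@Fintype.card Z instZ) ≤ B
  f : (k : Fin T) → ((Fin (t (k.val + 1))) → Yq q) → Z
  enc : (k : Fin (T + 1)) → M → (Fin k.val → Z) → (Fin (t (k.val + 1) - t k.val) → Xq q)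
  dec : (Fin n → Yq q) → M

namespace FeedbackCode

variable {q n B : ℕ} {M : Type*} (c : FeedbackCode q n B M)

theorem t_mono : ∀ {k j : ℕ}, k ≤ j → j ≤ c.T + 1 → c.t k ≤ c.t j := by
  intro k j hkj hj
  induction j with
  | zero => simp [Nat.le_zero.mp hkj]
  | succ j ih =>
    rcases Nat.eq_or_lt_of_le hkj with h | h
    · exact le_of_eq (congrArg c.t h)
    · exact le_trans (ih (Nat.lt_succ_iff.mp h) (by omega))
        (le_of_lt (c.htlt j (by omega)))

theorem t_le_n {k : ℕ} (hk : k ≤ c.T + 1) : c.t k ≤ n := by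
  have := c.t_mono hk (le_refl _)
  rwa [c.htn] at this

/-- The feedback symbols determined by a full received sequence `y`:
`zseq y k = f k (y₁,…,y_{t (k+1)})`. -/
def zseq (y : Fin n → Yq q) (k : Fin c.T) : c.Z :=
  c.f k (fun i => y ⟨i.val, lt_of_lt_of_le i.isLt (c.t_le_n (by have := k.isLt; omega))⟩)

/-- The index of the sub-codeword (block) containing position `i`:
the largest `k ≤ T` with `t k ≤ i`. -/
def blockIdx (i : ℕ) : ℕ := Nat.findGreatest (fun k => c.t k ≤ i) c.T

theorem blockIdx_le (i : ℕ) : c.blockIdx i ≤ c.T := Nat.findGreatest_le _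

theorem t_blockIdx_le (i : ℕ) : c.t (c.blockIdx i) ≤ i :=
  Nat.findGreatest_spec (P := fun k => c.t k ≤ i) (Nat.zero_le _) (by simp [c.ht0])

theorem lt_t_blockIdx_succ {i : ℕ} (hi : i < n) : i < c.t (c.blockIdx i + 1) := by
  by_cases h : c.blockIdx i = c.T
  · rw [h, c.htn]; exact hi
  · have h1 : c.blockIdx i + 1 ≤ c.T := by have := c.blockIdx_le i; omega
    have h2 := Nat.findGreatest_is_greatest (P := fun k => c.t k ≤ i)
      (Nat.lt_succ_self (c.blockIdx i)) h1
    simp only [Nat.succ_eq_add_one] at h2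
    omega

/-- The codeword symbol transmitted at position `i` when the message is `m` and the
received sequence is `y`: the concatenation over blocks of
`enc k m (z₁(y),…,z_k(y))`. It depends only on the values of `y` at positions `< i`. -/
def xword (m : M) (y : Fin n → Yq q) (i : Fin n) : Xq q :=
  c.enc ⟨c.blockIdx i.val, Nat.lt_succ_of_le (c.blockIdx_le i.val)⟩ m
    (fun j => c.zseq y ⟨j.val, lt_of_lt_of_le j.isLt (c.blockIdx_le i.val)⟩)
    ⟨i.val - c.t (c.blockIdx i.val), by
      show i.val - c.t (c.blockIdx i.val) < c.t (c.blockIdx i.val + 1) - c.t (c.blockIdx i.val)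
      have h1 := c.t_blockIdx_le i.val
      have h2 := c.lt_t_blockIdx_succ i.isLt
      omega⟩

/-- Number of erased positions of a received sequence. -/
noncomputable def numErasures (y : Fin n → Yq q) : ℕ :=
  Nat.card {i : Fin n // y i = none}

/-- Number of unerased positions of `y` whose symbol differs from the transmitted
codeword `x(m,y)`. -/
noncomputable def numErrors (m : M) (y : Fin n → Yq q) : ℕ :=
  Nat.card {i : Fin n // y i ≠ none ∧ y i ≠ some (c.xword m y i)}

/-- `y` is `(p,r)`-admissible for the message `m`: at most `rn` erasures and at most
`pn` symbol errors. -/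
def Admissible (p r : ℝ) (m : M) (y : Fin n → Yq q) : Prop :=
  (numErasures (q := q) y : ℝ) ≤ r * n ∧ (c.numErrors m y : ℝ) ≤ p * n

/-- The code is zero-error against `(p,r)`: the decoder recovers every message from every
`(p,r)`-admissible received sequence. -/
def ZeroError (p r : ℝ) : Prop :=
  ∀ m : M, ∀ y : Fin n → Yq q, c.Admissible p r m y → c.dec y = m

end FeedbackCode

/-- The `u`-th element of `X \ {x}`: the substituted symbol used by the babble attack,
guaranteed to differ from `x` and ranging uniformly over the `q−1` other symbols as
`u` ranges over `Fin (q−1)`. -/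
def subst {q : ℕ} (x : Fin q) (u : Fin (q - 1)) : Fin q :=
  if u.val < x.val then ⟨u.val, by have := u.isLt; have := x.isLt; omega⟩
  else ⟨u.val + 1, by have := u.isLt; omega⟩

/-- The received sequence produced by the babble attack during the first `b` channel
uses: for `i = 1,…,b` sequentially, the transmitted symbol `X_i` is the code's symbol
at time `i` given the message `m` and the feedback determined by the previous outputs,
and the output `Y_i` is a substituted symbol (determined by `u i`) if `i ∈ S`, and
`Y_i = X_i` otherwise. -/
def babbleY {q n B : ℕ} {M : Type*} (c : FeedbackCode q n B M) {b : ℕ} (hb : b ≤ n)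
    (m : M) (S : Finset (Fin b)) (u : Fin b → Fin (q - 1)) : (i : ℕ) → i < b → Fin q
  | i, hi =>
    let yprev : Fin n → Yq q := fun j =>
      if h : j.val < i then some (babbleY c hb m S u j.val (lt_trans h hi)) else none
    let x := c.xword m yprev ⟨i, lt_of_lt_of_le hi hb⟩
    if (⟨i, hi⟩ : Fin b) ∈ S then subst x (u ⟨i, hi⟩) else x
  termination_by i _ => i

/-- The babble-attack output as a function of the sample
`ω = (message, random set S of size p̄n, random substituted symbols)`. -/
def babbleOut {q n B : ℕ} {M : Type*} (c : FeedbackCode q n B M) {b : ℕ} (hb : b ≤ n)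
    {pn : ℕ} (ω : M × {S : Finset (Fin b) // S.card = pn} × (Fin b → Fin (q - 1))) :
    Fin b → Fin q :=
  fun i => babbleY c hb ω.1 ω.2.1.1 ω.2.2 i.val i.isLt

/-- The base-`q` Shannon entropy `H(M | Y_b = y)` of the conditional distribution of
`Mf` given `Yb = y`, for the uniform distribution on the finite sample space `Ω`. -/
noncomputable def condEnt {Ω M' W : Type*} [Fintype M'] (q : ℕ)
    (Mf : Ω → M') (Yb : Ω → W) (y : W) : ℝ :=
  -∑ m : M',
    ((Nat.card {ω : Ω // Mf ω = m ∧ Yb ω = y} : ℝ) /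
        (Nat.card {ω : Ω // Yb ω = y} : ℝ)) *
      Real.logb q ((Nat.card {ω : Ω // Mf ω = m ∧ Yb ω = y} : ℝ) /
        (Nat.card {ω : Ω // Yb ω = y} : ℝ))

theorem subst_ne {q : ℕ} (x : Fin q) (u : Fin (q - 1)) : subst x u ≠ x := by
  intro h
  have h := congrArg Fin.val h
  unfold subst at h
  split_ifs at h <;> simp at h <;> omega

theorem existsUnique_subst_eq {q : ℕ} {x y : Fin q} (h : y ≠ x) : ∃! u, subst x u = y := by
  have hne : y.val ≠ x.val := fun h' => h (Fin.ext h')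
  have hy := y.isLt
  have hx := x.isLt
  by_cases hlt : y.val < x.val
  · refine ⟨⟨y.val, by omega⟩, ?_, ?_⟩
    · simp [subst, hlt]
    · intro u hu
      have hu := congrArg Fin.val hu
      unfold subst at hu
      apply Fin.ext
      split_ifs at hu <;> simp at hu ⊢ <;> omega
  · refine ⟨⟨y.val - 1, by omega⟩, ?_, ?_⟩
    · apply Fin.ext
      unfold subst
      split_ifs with h1 <;> simp at h1 ⊢ <;> omega
    · intro u hu
      have hu := congrArg Fin.val hu
      unfold subst at hu
      apply Fin.ext
      split_ifs at hu <;> simp at hu ⊢ <;> omega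

/-- The symbol transmitted at time `i` for message `m` when the outputs so far agree with `y`. -/
def prefixWord {q n B : ℕ} {M : Type*} (c : FeedbackCode q n B M) {b : ℕ} (hb : b ≤ n)
    (m : M) (y : Fin b → Fin q) (i : Fin b) : Fin q :=
  c.xword m (fun j => if h : j.val < i.val then some (y ⟨j.val, h.trans i.isLt⟩) else none)
    ⟨i.val, lt_of_lt_of_le i.isLt hb⟩

theorem babbleY_eq_iff {q n B : ℕ} {M : Type*} (c : FeedbackCode q n B M) {b : ℕ} (hb : b ≤ n)
    (m : M) (S : Finset (Fin b)) (u : Fin b → Fin (q - 1)) (y : Fin b → Fin q) :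
    (fun i : Fin b => babbleY c hb m S u i.val i.isLt) = y ↔
      ∀ i, y i = if i ∈ S then subst (prefixWord c hb m y i) (u i)
        else prefixWord c hb m y i := by
  constructor
  · rintro rfl i
    simp only [prefixWord]
    rw [babbleY]
  · intro h
    have key : ∀ i (hi : i < b), babbleY c hb m S u i hi = y ⟨i, hi⟩ := by
      intro i
      induction i using Nat.strong_induction_on with
      | _ i ih =>
        intro hi
        have hprev : (fun j : Fin n => if h : j.val < i then
            some (babbleY c hb m S u j.val (lt_trans h hi)) else none) =
            fun j : Fin n => if h : j.val < i then
              some (y ⟨j.val, h.trans hi⟩) else none := by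
          funext j
          split_ifs with hj
          · rw [ih j.val hj]
          · rfl
        rw [babbleY, h ⟨i, hi⟩]
        simp only [prefixWord, hprev]
    funext i
    exact key i.val i.isLt

open Classical in
/-- For fixed inputs `x` and outputs `y`, the error set is determined by `x` and `y`, and the
substituted symbols are determined exactly on the error set. -/
theorem card_error_patterns {q b k : ℕ} (x y : Fin b → Fin q) :
    Nat.card {w : {S : Finset (Fin b) // S.card = k} × (Fin b → Fin (q - 1)) //
      ∀ i, y i = if i ∈ w.1.1 then subst (x i) (w.2 i) else x i} = 0 ∨
    Nat.card {w : {S : Finset (Fin b) // S.card = k} × (Fin b → Fin (q - 1)) //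
      ∀ i, y i = if i ∈ w.1.1 then subst (x i) (w.2 i) else x i} = (q - 1) ^ (b - k) := by
  set D : Finset (Fin b) := Finset.univ.filter fun i => y i ≠ x i with hD
  have hS : ∀ (S : Finset (Fin b)) (u : Fin b → Fin (q - 1)),
      (∀ i, y i = if i ∈ S then subst (x i) (u i) else x i) → S = D := by
    intro S u h
    ext i
    have hi := h i
    by_cases hiS : i ∈ S
    · rw [if_pos hiS] at hi
      simp [hD, hiS, hi, subst_ne]
    · rw [if_neg hiS] at hi
      simp [hD, hiS, hi]
  by_cases hDk : D.card = k
  · right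
    let P : Fin b → Finset (Fin (q - 1)) := fun i =>
      Finset.univ.filter fun v => i ∈ D → subst (x i) v = y i
    have e : {w : {S : Finset (Fin b) // S.card = k} × (Fin b → Fin (q - 1)) //
        ∀ i, y i = if i ∈ w.1.1 then subst (x i) (w.2 i) else x i} ≃
        {u : Fin b → Fin (q - 1) // u ∈ Fintype.piFinset P} :=
      { toFun := fun w => ⟨w.1.2, by
          rw [Fintype.mem_piFinset]
          intro i
          have h := w.2 i
          rw [hS _ _ w.2] at h
          simp only [P, Finset.mem_filter, Finset.mem_univ, true_and]
          intro hi
          rw [if_pos hi] at h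
          exact h.symm⟩
        invFun := fun u => ⟨(⟨D, hDk⟩, u.1), by
          intro i
          have h := Fintype.mem_piFinset.1 u.2 i
          simp only [P, Finset.mem_filter, Finset.mem_univ, true_and] at h
          by_cases hi : i ∈ D
          · simp only [hi, if_true]
            exact (h hi).symm
          · simp only [hi, if_false]
            by_contra hne
            exact hi (by simp [hD, hne])⟩
        left_inv := fun w => by
          apply Subtype.ext
          apply Prod.ext
          · exact Subtype.ext (hS _ _ w.2).symm
          · rfl
        right_inv := fun u => rfl }
    have hP : ∀ i, (P i).card = if i ∈ D then 1 else q - 1 := by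
      intro i
      by_cases hi : i ∈ D
      · rw [if_pos hi, Finset.card_eq_one]
        obtain ⟨v, hv, hv'⟩ := existsUnique_subst_eq (show y i ≠ x i by simpa [hD] using hi)
        refine ⟨v, ?_⟩
        ext w
        simp only [P, Finset.mem_filter, Finset.mem_univ, true_and, Finset.mem_singleton, hi,
          forall_const]
        exact ⟨hv' w, fun h => h ▸ hv⟩
      · simp [P, hi]
    rw [Nat.card_congr e, Nat.card_eq_fintype_card, Fintype.card_coe, Fintype.card_piFinset]
    simp_rw [hP]
    rw [Finset.prod_ite, Finset.prod_const_one, one_mul, Finset.prod_const]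
    congr 1
    rw [← hDk, Finset.filter_not, Finset.card_sdiff]
    simp
  · left
    rw [Nat.card_eq_zero]
    left
    exact ⟨fun w => hDk (hS _ _ w.2 ▸ w.1.1.2)⟩

/-- Every output sequence is produced from a given message by either no or exactly
`(q - 1) ^ (b - pn)` choices of the attack's randomness. -/
theorem card_babbleOut_fiber {q n B : ℕ} {M : Type*} (c : FeedbackCode q n B M) {b : ℕ}
    (hb : b ≤ n) {pn : ℕ} (m : M) (y : Fin b → Fin q) :
    Nat.card {ω : M × {S : Finset (Fin b) // S.card = pn} × (Fin b → Fin (q - 1)) //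
      ω.1 = m ∧ babbleOut c hb ω = y} = 0 ∨
    Nat.card {ω : M × {S : Finset (Fin b) // S.card = pn} × (Fin b → Fin (q - 1)) //
      ω.1 = m ∧ babbleOut c hb ω = y} = (q - 1) ^ (b - pn) := by
  classical
  have e : {ω : M × {S : Finset (Fin b) // S.card = pn} × (Fin b → Fin (q - 1)) //
      ω.1 = m ∧ babbleOut c hb ω = y} ≃
      {w : {S : Finset (Fin b) // S.card = pn} × (Fin b → Fin (q - 1)) //
        ∀ i, y i = if i ∈ w.1.1 then subst (prefixWord c hb m y i) (w.2 i)
          else prefixWord c hb m y i} :=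
    { toFun := fun ω => ⟨ω.1.2, by
        obtain ⟨⟨m', w⟩, rfl, h⟩ := ω
        have := (babbleY_eq_iff c hb m' w.1.1 w.2 y).1 h
        convert this⟩
      invFun := fun w => ⟨(m, w.1), rfl, (babbleY_eq_iff c hb m w.1.1.1 w.1.2 y).2 (by
        convert w.2)⟩
      left_inv := by
        rintro ⟨⟨m', w⟩, rfl, h⟩
        rfl
      right_inv := fun w => rfl }
  rw [Nat.card_congr e]
  convert card_error_patterns (k := pn) (prefixWord c hb m y) y

theorem natCard_eq_sum_fiber {Ω M' : Type*} [Fintype Ω] [Fintype M'] (f : Ω → M')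
    (P : Ω → Prop) :
    Nat.card {ω // P ω} = ∑ m, Nat.card {ω // f ω = m ∧ P ω} := by
  classical
  simp_rw [Nat.card_eq_fintype_card, Fintype.card_subtype]
  rw [Finset.card_eq_sum_card_fiberwise (f := f) (t := Finset.univ) (by simp)]
  refine Finset.sum_congr rfl fun m _ => ?_
  rw [Finset.filter_filter]
  congr 1
  ext ω
  simp [and_comm]

section FlatPosterior

variable {Ω M' W : Type*} [Fintype Ω] [Fintype M'] {q L : ℕ} {f : Ω → M'} {Y : Ω → W}

/-- If all nonempty joint fibers over `y` have size `L`, the posterior is uniform and its entropy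
is the logarithm of the size of its support. -/
theorem condEnt_eq_logb {y : W} (hT : 0 < Nat.card {ω // Y ω = y})
    (h : ∀ m, Nat.card {ω // f ω = m ∧ Y ω = y} = 0 ∨
      Nat.card {ω // f ω = m ∧ Y ω = y} = L) :
    condEnt q f Y y = Real.logb q ((Nat.card {ω // Y ω = y} : ℝ) / L) := by
  set T := Nat.card {ω // Y ω = y} with hTdef
  have hsum : (∑ m, (Nat.card {ω // f ω = m ∧ Y ω = y} : ℝ) / T) = 1 := by
    rw [← Finset.sum_div, ← Nat.cast_sum, ← natCard_eq_sum_fiber f fun ω => Y ω = y]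
    exact div_self (by exact_mod_cast hT.ne')
  have hterm : ∀ m, ((Nat.card {ω // f ω = m ∧ Y ω = y} : ℝ) / T) *
      Real.logb q ((Nat.card {ω // f ω = m ∧ Y ω = y} : ℝ) / T) =
      ((Nat.card {ω // f ω = m ∧ Y ω = y} : ℝ) / T) * -Real.logb q ((T : ℝ) / L) := by
    intro m
    rcases h m with h0 | h1
    · simp [h0]
    · rw [h1, ← Real.logb_inv, inv_div]
  rw [condEnt, Finset.sum_congr rfl fun m _ => hterm m, ← Finset.sum_mul, hsum]
  ring

theorem card_condEnt_lt_le [Fintype W] (hq : 1 < q) (hL : 0 < L)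
    (h : ∀ m y, Nat.card {ω // f ω = m ∧ Y ω = y} = 0 ∨
      Nat.card {ω // f ω = m ∧ Y ω = y} = L) (t : ℝ) :
    (Nat.card {ω // condEnt q f Y (Y ω) < t} : ℝ) ≤ Fintype.card W * (L * (q : ℝ) ^ t) := by
  rw [natCard_eq_sum_fiber Y, Nat.cast_sum]
  have hbound : ∀ y, (Nat.card {ω // Y ω = y ∧ condEnt q f Y (Y ω) < t} : ℝ) ≤
      L * (q : ℝ) ^ t := by
    intro y
    rcases isEmpty_or_nonempty {ω // Y ω = y ∧ condEnt q f Y (Y ω) < t} with he | ⟨ω, hω, hlt⟩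
    · rw [Nat.card_of_isEmpty, Nat.cast_zero]
      positivity
    · have hle : Nat.card {ω // Y ω = y ∧ condEnt q f Y (Y ω) < t} ≤
          Nat.card {ω // Y ω = y} :=
        Nat.card_le_card_of_injective (fun ω => ⟨ω.1, ω.2.1⟩) fun a b hab => by
          simpa [Subtype.ext_iff] using hab
      have : Nonempty {ω // Y ω = y} := ⟨⟨ω, hω⟩⟩
      have hT : 0 < Nat.card {ω // Y ω = y} := Nat.card_pos
      have hq' : (1 : ℝ) < q := by exact_mod_cast hq
      have hL' : (0 : ℝ) < L := by exact_mod_cast hL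
      have hT' : (0 : ℝ) < Nat.card {ω // Y ω = y} := by exact_mod_cast hT
      rw [hω, condEnt_eq_logb hT fun m => h m y, Real.logb_lt_iff_lt_rpow hq' (by positivity),
        div_lt_iff₀ hL'] at hlt
      calc (Nat.card {ω // Y ω = y ∧ condEnt q f Y (Y ω) < t} : ℝ)
          ≤ Nat.card {ω // Y ω = y} := by exact_mod_cast hle
        _ ≤ L * (q : ℝ) ^ t := by linarith
  calc _ ≤ ∑ _y : W, (L : ℝ) * (q : ℝ) ^ t := Finset.sum_le_sum fun y _ => hbound y
    _ = _ := by simp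

end FlatPosterior

theorem factorial_le_factorial_mul_pow_sub {j k : ℕ} (h : j ≤ k) :
    k.factorial ≤ j.factorial * k ^ (k - j) := by
  rw [← Nat.factorial_mul_descFactorial (Nat.sub_le k j), Nat.sub_sub_self h]
  gcongr
  exact Nat.descFactorial_le_pow k (k - j)

theorem factorial_mul_pow_le_factorial_mul_pow_self (k j : ℕ) :
    k.factorial * k ^ j ≤ j.factorial * k ^ k := by
  rcases le_total k j with h | h
  · have := Nat.factorial_mul_pow_sub_le_factorial h
    calc k.factorial * k ^ j = k.factorial * k ^ (j - k) * k ^ k := by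
          rw [mul_assoc, ← pow_add, Nat.sub_add_cancel h]
      _ ≤ _ := by gcongr
  · have := factorial_le_factorial_mul_pow_sub h
    calc k.factorial * k ^ j ≤ j.factorial * k ^ (k - j) * k ^ j := by gcongr
      _ = _ := by rw [mul_assoc, ← pow_add, Nat.sub_add_cancel h]

/-- The term of index `k` is the largest in the binomial expansion of `(k + l) ^ (k + l)`. -/
theorem choose_mul_pow_mul_pow_le (k l j : ℕ) (hj : j ≤ k + l) :
    k ^ j * l ^ (k + l - j) * (k + l).choose j ≤ k ^ k * l ^ l * (k + l).choose k := by
  obtain ⟨m, hm⟩ := Nat.exists_eq_add_of_le hj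
  have hj' : (k + l).choose j * j.factorial * m.factorial = (k + l).factorial := by
    rw [← Nat.choose_mul_factorial_mul_factorial hj, show k + l - j = m by omega]
  have hk' : (k + l).choose k * k.factorial * l.factorial = (k + l).factorial := by
    rw [← Nat.choose_mul_factorial_mul_factorial (Nat.le_add_right k l), Nat.add_sub_cancel_left]
  rw [show k + l - j = m by omega]
  have h := Nat.mul_le_mul (factorial_mul_pow_le_factorial_mul_pow_self k j)
    (factorial_mul_pow_le_factorial_mul_pow_self l m)
  refine Nat.le_of_mul_le_mul_right ?_
    (show 0 < j.factorial * m.factorial * (k.factorial * l.factorial) by positivity)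
  calc k ^ j * l ^ m * (k + l).choose j * (j.factorial * m.factorial * (k.factorial * l.factorial))
      = (k + l).choose j * j.factorial * m.factorial *
          (k.factorial * k ^ j * (l.factorial * l ^ m)) := by ring
    _ ≤ (k + l).choose j * j.factorial * m.factorial *
          (j.factorial * k ^ k * (m.factorial * l ^ l)) := by gcongr
    _ = (k + l).choose k * k.factorial * l.factorial *
          (j.factorial * k ^ k * (m.factorial * l ^ l)) := by rw [hj', hk']
    _ = _ := by ring

theorem pow_self_le_succ_mul_choose (k l : ℕ) :
    (k + l) ^ (k + l) ≤ (k + l + 1) * (k ^ k * l ^ l * (k + l).choose k) := by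
  rw [add_pow]
  calc _ ≤ ∑ _j ∈ Finset.range (k + l + 1), k ^ k * l ^ l * (k + l).choose k :=
        Finset.sum_le_sum fun j hj =>
          choose_mul_pow_mul_pow_le k l j (Nat.lt_succ_iff.1 (Finset.mem_range.1 hj))
    _ = _ := by simp

/-- Gibbs' inequality for two-point distributions, in the form saying that `a * H(k / a)` is
monotone in `a`. -/
theorem mul_binEntropy_mono {k a b : ℝ} (hk : 0 < k) (hka : k < a) (hab : a ≤ b) :
    -(k * Real.log (k / a)) - (a - k) * Real.log (1 - k / a) ≤
      -(k * Real.log (k / b)) - (b - k) * Real.log (1 - k / b) := by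
  have ha : 0 < a := hk.trans hka
  have hb : 0 < b := ha.trans_le hab
  have hxa : 0 < 1 - k / a := by rw [sub_pos, div_lt_one ha]; exact hka
  have hxb : 0 < 1 - k / b := by rw [sub_pos, div_lt_one hb]; linarith
  have h1 : Real.log (k / b) - Real.log (k / a) ≤ (k / b) / (k / a) - 1 := by
    rw [← Real.log_div (by positivity) (by positivity)]
    exact Real.log_le_sub_one_of_pos (by positivity)
  have h2 : Real.log (1 - k / b) - Real.log (1 - k / a) ≤ (1 - k / b) / (1 - k / a) - 1 := by
    rw [← Real.log_div hxb.ne' hxa.ne']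
    exact Real.log_le_sub_one_of_pos (by positivity)
  have h3 : (b - a) * Real.log (1 - k / b) ≤ 0 :=
    mul_nonpos_of_nonneg_of_nonpos (by linarith)
      (Real.log_nonpos hxb.le (by have : 0 < k / b := by positivity
                                  linarith))
  have h4 := mul_le_mul_of_nonneg_left h1 hk.le
  have h5 := mul_le_mul_of_nonneg_left h2 (sub_pos.2 hka).le
  have h6 : k * ((k / b) / (k / a) - 1) + (a - k) * ((1 - k / b) / (1 - k / a) - 1) = 0 := by
    have hak : a - k ≠ 0 := (sub_pos.2 hka).ne'
    have : 1 - k / a = (a - k) / a := by field_simp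
    rw [this]
    field_simp
    ring
  nlinarith

theorem rpow_mul_Hq_le {q k b : ℕ} (hq : 2 ≤ q) {a : ℝ} (hka : (k : ℝ) < a) (hab : a ≤ b) :
    (q : ℝ) ^ (a * Hq q (k / a)) ≤ (b + 1) * (b.choose k * ((q : ℝ) - 1) ^ k) := by
  have hq2 : (2 : ℝ) ≤ q := by exact_mod_cast hq
  have hkb : k < b := by exact_mod_cast hka.trans_le hab
  have hc : (0 : ℝ) < b.choose k := by exact_mod_cast Nat.choose_pos hkb.le
  have hc1 : (1 : ℝ) ≤ b.choose k := by exact_mod_cast Nat.choose_pos hkb.le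
  have hlq : 0 < Real.log q := Real.log_pos (by linarith)
  have hq1 : (0 : ℝ) < (q : ℝ) - 1 := by linarith
  have ha : 0 < a := lt_of_le_of_lt (Nat.cast_nonneg k) hka
  rw [← Real.log_le_log_iff (by positivity) (by positivity), Real.log_rpow (by linarith),
    ← mul_assoc, Real.log_mul (by positivity) (by positivity), Real.log_pow]
  have hH : a * Hq q (k / a) * Real.log q = k * Real.log ((q : ℝ) - 1) +
      (-(k * Real.log (k / a)) - (a - k) * Real.log (1 - k / a)) := by
    unfold Hq Real.logb
    field_simp
    ring
  rw [hH, add_comm]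
  gcongr
  rcases Nat.eq_zero_or_pos k with rfl | hk
  · simp only [Nat.choose_zero_right, Nat.cast_one, mul_one]
    simp only [Nat.cast_zero, zero_div, Real.log_zero, mul_zero, sub_zero, Real.log_one,
      neg_zero]
    exact Real.log_nonneg (by linarith [(Nat.cast_nonneg b : (0 : ℝ) ≤ b)])
  have hk' : (0 : ℝ) < k := by exact_mod_cast hk
  refine (mul_binEntropy_mono hk' hka hab).trans ?_
  obtain ⟨l, rfl⟩ := Nat.exists_eq_add_of_lt hkb
  rw [add_assoc] at *
  set l' := l + 1 with hl'
  have hl : (0 : ℝ) < l' := by exact_mod_cast Nat.succ_pos l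
  have hpow : ((k + l' : ℕ) : ℝ) ^ (k + l') ≤
      (((k + l' : ℕ) : ℝ) + 1) * ((k : ℝ) ^ k * (l' : ℝ) ^ l' * (k + l').choose k) := by
    exact_mod_cast pow_self_le_succ_mul_choose k l'
  have hlog := Real.log_le_log (by positivity) hpow
  rw [Real.log_mul (by positivity) (by positivity), Real.log_mul (by positivity) (by positivity),
    Real.log_mul (by positivity) (by positivity), Real.log_pow, Real.log_pow, Real.log_pow] at hlog
  have h1 : (1 : ℝ) - k / ((k + l' : ℕ) : ℝ) = l' / ((k + l' : ℕ) : ℝ) := by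
    push_cast
    field_simp
    ring
  rw [h1, Real.log_mul (by positivity) (by positivity), Real.log_div (by positivity) (by positivity),
    Real.log_div (by positivity) (by positivity)]
  have h2 : ((k + l' : ℕ) : ℝ) - k = l' := by push_cast; ring
  rw [h2]
  push_cast at hlog ⊢
  linarith

theorem exists_forall_succ_mul_rpow_lt {q ε δ : ℝ} (hq : 1 < q) (hε : 0 < ε) (hδ : 0 < δ) :
    ∃ n₀ : ℕ, ∀ n : ℕ, n₀ ≤ n → ((n : ℝ) + 1) * q ^ (-(ε * n)) < δ := by
  have hr0 : 0 ≤ q ^ (-ε) := by positivity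
  have hr1 : q ^ (-ε) < 1 := Real.rpow_lt_one_of_one_lt_of_neg hq (by linarith)
  have h := (tendsto_self_mul_const_pow_of_lt_one hr0 hr1).add
    (tendsto_pow_atTop_nhds_zero_of_lt_one hr0 hr1)
  rw [add_zero] at h
  obtain ⟨n₀, hn₀⟩ := Filter.eventually_atTop.1 (h.eventually_lt_const hδ)
  refine ⟨n₀, fun n hn => ?_⟩
  have := hn₀ n hn
  rw [← neg_mul, Real.rpow_mul (by linarith), Real.rpow_natCast]
  linarith

/-- Residual uncertainty after the babble attack (Lemma thm:F_0).
Let q ≥ 2, let p, r ∈ [0,1] with 2p + r < (q−1)/q, let ε_R > 0, let p̄ ∈ [0,p] be a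
minimizer defining C₀(q,p,r), set R = C₀(q,p,r) + ε_R, and assume α(p̄) + ε_R/2 ≤ 1.
Then for all sufficiently large n for which p̄n and b = (α(p̄) + ε_R/2)n are integers,
for every B-bit feedback code of blocklength n (any B) with message set of size
⌈q^{Rn}⌉, taking M uniform on the message set and the babble attack generating
(X_i, Y_i) for i ≤ b, one has P( H(M | Y_b = y) ≥ n·ε_R/4 ) > ε_R/8, the probability
being over the realization y of Y_b (jointly over M, the random set S and the random
substituted symbols, i.e. over the uniform sample space Ω), and H(M | Y_b = y) being
the base-q Shannon entropy of the conditional distribution of M given Y_b = y. -/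
theorem babble_residual_uncertainty (q : ℕ) (hq : 2 ≤ q) (p r : ℝ)
    (hp : p ∈ Set.Icc (0 : ℝ) 1) (hr : r ∈ Set.Icc (0 : ℝ) 1)
    (hpr : 2 * p + r < ((q : ℝ) - 1) / q) (εR : ℝ) (hεR : 0 < εR)
    (pb : ℝ) (hpb : pb ∈ Set.Icc 0 p)
    (hmin : alphaEE q p r pb * (1 - Hq q (pb / alphaEE q p r pb)) = C0 q p r)
    (hab : alphaEE q p r pb + εR / 2 ≤ 1) :
    ∃ n₀ : ℕ, ∀ n : ℕ, n₀ ≤ n → ∀ pn b : ℕ,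
      (pn : ℝ) = pb * n → (b : ℝ) = (alphaEE q p r pb + εR / 2) * n →
      ∀ hb : b ≤ n, ∀ B : ℕ,
      ∀ c : FeedbackCode q n B (Fin ⌈(q : ℝ) ^ ((C0 q p r + εR) * n)⌉₊),
        εR / 8 <
          (Nat.card {ω : Fin ⌈(q : ℝ) ^ ((C0 q p r + εR) * n)⌉₊ ×
              {S : Finset (Fin b) // S.card = pn} × (Fin b → Fin (q - 1)) //
            (n : ℝ) * εR / 4 ≤
              condEnt q Prod.fst (babbleOut c hb (pn := pn)) (babbleOut c hb (pn := pn) ω)} : ℝ) /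
          (Nat.card (Fin ⌈(q : ℝ) ^ ((C0 q p r + εR) * n)⌉₊ ×
              {S : Finset (Fin b) // S.card = pn} × (Fin b → Fin (q - 1))) : ℝ) := by
  have hq2 : (2 : ℝ) ≤ q := by exact_mod_cast hq
  have hq1 : (0 : ℝ) < (q : ℝ) - 1 := by linarith
  have hq0 : (0 : ℝ) < q := by linarith
  set a := alphaEE q p r pb with ha_def
  have ha : pb < a := by
    have h1 : (q : ℝ) / (q - 1) * (2 * p + r) < 1 := by
      rw [lt_div_iff₀ hq0] at hpr
      rw [div_mul_eq_mul_div, div_lt_one hq1]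
      linarith
    have h2 : 1 ≤ (q : ℝ) / (q - 1) := by
      rw [le_div_iff₀ hq1]
      linarith
    have h3 : a = 1 - (q : ℝ) / (q - 1) * (2 * p + r) + 2 * ((q : ℝ) / (q - 1) * pb) := by
      rw [ha_def, alphaEE]
      ring
    nlinarith [hpb.1]
  have ha0 : 0 < a := lt_of_le_of_lt hpb.1 ha
  have hδ : (0 : ℝ) < 1 - εR / 8 := by linarith
  obtain ⟨n₀, hn₀⟩ := exists_forall_succ_mul_rpow_lt (q := q) (ε := εR / 4)
    (by linarith) (by linarith) hδ
  refine ⟨n₀ + 1, fun n hn pn b hpn hbn hb B => ?_⟩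
  have hN := Nat.le_ceil ((q : ℝ) ^ ((C0 q p r + εR) * n))
  generalize ⌈(q : ℝ) ^ ((C0 q p r + εR) * n)⌉₊ = N at hN ⊢
  intro c
  have hn1 : (0 : ℝ) < n := by exact_mod_cast (by omega : 0 < n)
  have hsmall := hn₀ n (by omega)
  have hpnan : (pn : ℝ) < a * n := by rw [hpn]; gcongr
  have hanb : a * n ≤ b := by rw [hbn]; gcongr; linarith
  have hpnb : pn ≤ b := by exact_mod_cast (hpnan.trans_le hanb).le
  have hV := rpow_mul_Hq_le hq hpnan hanb
  rw [show (pn : ℝ) / (a * n) = pb / a by rw [hpn]; field_simp] at hV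
  have hN0 : (0 : ℝ) < N := lt_of_lt_of_le (by positivity) hN
  have hL : 0 < (q - 1) ^ (b - pn) := Nat.pow_pos (by omega)
  have hbad := card_condEnt_lt_le (f := Prod.fst) (Y := babbleOut c hb (pn := pn)) (q := q)
    (by omega) hL (fun m y => card_babbleOut_fiber c hb m y) ((n : ℝ) * εR / 4)
  have hcard : (Nat.card (Fin N × {S : Finset (Fin b) // S.card = pn} ×
      (Fin b → Fin (q - 1))) : ℝ) = N * (b.choose pn * ((q : ℝ) - 1) ^ b) := by
    simp [Nat.card_eq_fintype_card, Nat.cast_sub (by omega : 1 ≤ q)]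
  have hsplit := Nat.card_congr (Equiv.sumCompl fun ω : Fin N ×
      {S : Finset (Fin b) // S.card = pn} × (Fin b → Fin (q - 1)) => (n : ℝ) * εR / 4 ≤
        condEnt q Prod.fst (babbleOut c hb (pn := pn)) (babbleOut c hb (pn := pn) ω))
  rw [Nat.card_sum] at hsplit
  simp only [not_le] at hsplit
  have hsplit' := congrArg (Nat.cast : ℕ → ℝ) hsplit
  rw [Nat.cast_add, hcard] at hsplit'
  have hc : (0 : ℝ) < b.choose pn := by exact_mod_cast Nat.choose_pos hpnb
  have htot : 0 < (N : ℝ) * (b.choose pn * ((q : ℝ) - 1) ^ b) := by positivity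
  rw [hcard, lt_div_iff₀ htot]
  have hqb : (Fintype.card (Fin b → Fin q) : ℝ) = (q : ℝ) ^ (b : ℝ) := by
    simp
  rw [hqb, Nat.cast_pow, Nat.cast_sub (by omega : 1 ≤ q), Nat.cast_one] at hbad
  have hpow : ((q : ℝ) - 1) ^ b = ((q : ℝ) - 1) ^ pn * ((q : ℝ) - 1) ^ (b - pn) := by
    rw [← pow_add, Nat.add_sub_cancel' hpnb]
  have hexp : (q : ℝ) ^ (b : ℝ) * (q : ℝ) ^ ((n : ℝ) * εR / 4) =
      (q : ℝ) ^ (-(εR / 4 * n)) * ((q : ℝ) ^ ((C0 q p r + εR) * n) *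
        (q : ℝ) ^ (a * n * Hq q (pb / a))) := by
    rw [← Real.rpow_add hq0, ← Real.rpow_add hq0, ← Real.rpow_add hq0, hbn, ← hmin]
    congr 1
    ring
  have hbn' : (b : ℝ) ≤ n := by exact_mod_cast hb
  have hkey : (q : ℝ) ^ (b : ℝ) * (((q : ℝ) - 1) ^ (b - pn) * (q : ℝ) ^ ((n : ℝ) * εR / 4)) <
      (1 - εR / 8) * (N * (b.choose pn * ((q : ℝ) - 1) ^ b)) := by
    calc _ = ((q : ℝ) - 1) ^ (b - pn) *
          ((q : ℝ) ^ (b : ℝ) * (q : ℝ) ^ ((n : ℝ) * εR / 4)) := by ring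
      _ ≤ ((q : ℝ) - 1) ^ (b - pn) * ((q : ℝ) ^ (-(εR / 4 * n)) *
          (N * ((n + 1) * (b.choose pn * ((q : ℝ) - 1) ^ pn)))) := by
        rw [hexp]
        gcongr
        refine hV.trans ?_
        gcongr
      _ = ((n + 1) * (q : ℝ) ^ (-(εR / 4 * n))) *
          (N * (b.choose pn * ((q : ℝ) - 1) ^ b)) := by rw [hpow]; ring
      _ < _ := by gcongr
  linarith
end
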